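/- Let λ, τ, μ be partitions with |μ| ≥ |λ| + |τ|, and let N ≥ |μ| be an integer. In the polynomial ring ℚ[y_1,…,y_N] there exist unique rationals (c_ν), indexed by the partitions ν of |μ|, such that h_{|μ|−|λ|−|τ|}·h_{λ_1}⋯h_{λ_{ℓ(λ)}}·e_{τ_1}⋯e_{τ_{ℓ(τ)}} = Σ_{ν ⊢ |μ|} c_ν·p_ν; and moreover z_μ·c_μ = Σ_F wt(F), where F runs over all functions assigning to each row r ∈ {1,…,ℓ(μ)} of μ either no label, or an unprimed label i ∈ {1,…,ℓ(λ)}, or a primed label j' with j ∈ {1,…,ℓ(τ)}, subject to: for each i the total length Σ of the rows labeled i equals λ_i, and for each j the total length of the rows labeled j' equals τ_j; and wt(F) = ∏_{rows r carrying a primed label} (−1)^{μ_r + 1}. -/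

import Mathlib

/-- The power sum `p_r = y_1^r + ⋯ + y_N^r` in `ℚ[y_1,…,y_N]`. -/
noncomputable def pN (N r : ℕ) : MvPolynomial (Fin N) ℚ :=
  ∑ i, MvPolynomial.X i ^ r

/-- The complete homogeneous symmetric polynomial `h_a` in `ℚ[y_1,…,y_N]`. -/
noncomputable def hN (N a : ℕ) : MvPolynomial (Fin N) ℚ :=
  ∑ s : Sym (Fin N) a, ((s : Multiset (Fin N)).map MvPolynomial.X).prod

/-- The elementary symmetric polynomial `e_b` in `ℚ[y_1,…,y_N]`. -/
noncomputable def eN (N b : ℕ) : MvPolynomial (Fin N) ℚ :=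
  ∑ E ∈ Finset.univ.powersetCard b, ∏ i ∈ E, MvPolynomial.X i

/-- `z_μ = ∏_i i^{c_i}·c_i!` where `c_i` is the number of parts of `μ` equal to `i`. -/
def zPart {k : ℕ} (μ : k.Partition) : ℕ :=
  ∏ i ∈ μ.parts.toFinset, i ^ μ.parts.count i * Nat.factorial (μ.parts.count i)

section Aux
open MvPolynomial

noncomputable def GG (ε : ℚ) : ℕ → MvPolynomial ℕ ℚ
  | 0 => 1
  | n + 1 => C (1 / ((n : ℚ) + 1)) *
      ∑ i : Fin (n + 1), C (ε ^ ((i : ℕ) + 2)) * X ((i : ℕ) + 1) * GG ε (n - i)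
decreasing_by omega

theorem GG_zero (ε : ℚ) : GG ε 0 = 1 := by rw [GG]

theorem GG_rec (ε : ℚ) (n : ℕ) : C (n : ℚ) * GG ε n =
    ∑ i ∈ Finset.range n, C (ε ^ (i + 2)) * X (i + 1) * GG ε (n - (i + 1)) := by
  cases n with
  | zero => simp
  | succ n =>
    rw [GG, ← mul_assoc, ← C_mul, Finset.sum_range]
    have : ((n + 1 : ℕ) : ℚ) * (1 / ((n : ℚ) + 1)) = 1 := by
      push_cast; field_simp
    rw [this, C_1, one_mul]
    refine Finset.sum_congr rfl fun i _ => ?_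
    congr 2
    omega

theorem C_cancel {σ : Type*} {n : ℕ} (hn : n ≠ 0) {p q : MvPolynomial σ ℚ}
    (h : C (n : ℚ) * p = C (n : ℚ) * q) : p = q := by
  have h2 := congrArg (fun x => C ((n : ℚ)⁻¹) * x) h
  have : (n : ℚ)⁻¹ * n = 1 := by field_simp
  simpa only [← mul_assoc, ← C_mul, this, C_1, one_mul] using h2

noncomputable def DD (r : ℕ) : Derivation ℚ (MvPolynomial ℕ ℚ) (MvPolynomial ℕ ℚ) :=
  (r : ℚ) • pderiv r

theorem DD_X (r s : ℕ) : DD r (X s) = if s = r then C (r : ℚ) else 0 := by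
  simp only [DD, Derivation.smul_apply, pderiv_X, Pi.single_apply]
  split_ifs
  · simp [smul_eq_C_mul]
  all_goals simp_all

theorem DD_C (r : ℕ) (a : ℚ) : DD r (C a) = 0 := by simp [DD]

theorem DD_GG (ε : ℚ) (r : ℕ) (hr : 0 < r) (n : ℕ) :
    DD r (GG ε n) = if r ≤ n then C (ε ^ (r + 1)) * GG ε (n - r) else 0 := by
  induction n using Nat.strong_induction_on with
  | _ n ih =>
  rcases Nat.eq_zero_or_pos n with rfl | hn
  · rw [GG_zero, if_neg (by omega)]; simp
  apply C_cancel hn.ne'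
  have h1 : C (n : ℚ) * DD r (GG ε n) = DD r (C (n : ℚ) * GG ε n) := by
    rw [Derivation.leibniz, DD_C]; simp
  rw [h1, GG_rec, map_sum]
  have h2 : ∀ i ∈ Finset.range n, DD r (C (ε ^ (i + 2)) * X (i + 1) * GG ε (n - (i + 1))) =
      (if i + 1 = r then C (ε ^ (r + 1)) * C (r : ℚ) * GG ε (n - r) else 0) +
      (if i + 1 ≤ n - r then C (ε ^ (r + 1)) *
        (C (ε ^ (i + 2)) * X (i + 1) * GG ε (n - r - (i + 1))) else 0) := by
    intro i hi
    rw [Finset.mem_range] at hi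
    rw [Derivation.leibniz, Derivation.leibniz, DD_C, DD_X, ih _ (by omega)]
    have e1 : (r ≤ n - (i + 1)) ↔ i + 1 ≤ n - r := by omega
    simp only [e1, smul_eq_mul]
    have e2 : n - (i + 1) - r = n - r - (i + 1) := by omega
    rw [e2]
    by_cases h3 : i + 1 = r
    · rw [if_pos h3, if_pos h3]
      subst h3
      split_ifs <;> ring
    · rw [if_neg h3, if_neg h3]
      split_ifs <;> ring
  rw [Finset.sum_congr rfl h2, Finset.sum_add_distrib]
  by_cases hrn : r ≤ n
  · rw [if_pos hrn]
    have e3 : ∑ i ∈ Finset.range n,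
        (if i + 1 = r then C (ε ^ (r + 1)) * C (r : ℚ) * GG ε (n - r) else 0) =
        C (ε ^ (r + 1)) * C (r : ℚ) * GG ε (n - r) := by
      rw [Finset.sum_eq_single (r - 1)]
      · rw [if_pos (by omega)]
      · intro b _ hb; rw [if_neg (by omega)]
      · intro h; simp at h; omega
    have e4 : ∑ i ∈ Finset.range n, (if i + 1 ≤ n - r then C (ε ^ (r + 1)) *
        (C (ε ^ (i + 2)) * X (i + 1) * GG ε (n - r - (i + 1))) else 0) =
        C (ε ^ (r + 1)) * (C ((n - r : ℕ) : ℚ) * GG ε (n - r)) := by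
      rw [GG_rec, Finset.mul_sum, ← Finset.sum_filter]
      refine Finset.sum_congr ?_ fun _ _ => rfl
      ext i; simp; omega
    rw [e3, e4, Nat.cast_sub hrn, C_sub]; ring
  · rw [if_neg hrn]
    rw [Finset.sum_eq_zero, Finset.sum_eq_zero]; simp
    · intro i hi; rw [if_neg (by omega)]
    · intro i hi; simp at hi; rw [if_neg (by omega)]

noncomputable def TT : List ℕ → MvPolynomial ℕ ℚ →ₗ[ℚ] ℚ
  | [] => (aeval (fun _ => (0 : ℚ))).toLinearMap
  | r :: l => (TT l).comp (DD r : MvPolynomial ℕ ℚ →ₗ[ℚ] MvPolynomial ℕ ℚ)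

theorem TT_nil (q) : TT [] q = aeval (fun _ => (0 : ℚ)) q := rfl
theorem TT_cons (r l q) : TT (r :: l) q = TT l (DD r q) := rfl

theorem aeval_zero_GG (ε : ℚ) (n : ℕ) :
    aeval (fun _ => (0 : ℚ)) (GG ε n) = if 0 = n then 1 else 0 := by
  cases n with
  | zero => simp [GG_zero]
  | succ n => rw [GG]; simp

theorem derivation_prod {K : Type*} [DecidableEq K] (D : Derivation ℚ (MvPolynomial ℕ ℚ) (MvPolynomial ℕ ℚ))
    (s : Finset K) (f : K → MvPolynomial ℕ ℚ) :
    D (∏ k ∈ s, f k) = ∑ k ∈ s, ∏ j ∈ s, Function.update f k (D (f k)) j := by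
  induction s using Finset.induction_on with
  | empty => simp
  | insert a s ha ih =>
    rw [Finset.prod_insert ha, Derivation.leibniz, ih, Finset.sum_insert ha, Finset.prod_insert ha,
      Function.update_self, add_comm, smul_eq_mul, smul_eq_mul, mul_comm]
    congr 1
    · congr 1
      refine Finset.prod_congr rfl fun j hj => ?_
      rw [Function.update_of_ne]; rintro rfl; exact ha hj
    · rw [Finset.mul_sum]
      refine Finset.sum_congr rfl fun k hk => ?_
      rw [Finset.prod_insert ha, Function.update_of_ne]; rintro rfl; exact ha hk

theorem DD_prod {K : Type*} [DecidableEq K] [Fintype K] (ε : K → ℚ) (d : K → ℕ) (r : ℕ) (hr : 0 < r) :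
    DD r (∏ k, GG (ε k) (d k)) = ∑ k, if r ≤ d k then
      ε k ^ (r + 1) • ∏ j, GG (ε j) (Function.update d k (d k - r) j) else 0 := by
  rw [derivation_prod]
  refine Finset.sum_congr rfl fun k _ => ?_
  have h1 : ∀ q, ∏ j, Function.update (fun k => GG (ε k) (d k)) k q j =
      q * ∏ j ∈ Finset.univ.erase k, GG (ε j) (d j) := by
    intro q
    rw [← Finset.mul_prod_erase _ _ (Finset.mem_univ k), Function.update_self]
    congr 1
    refine Finset.prod_congr rfl fun j hj => ?_
    rw [Function.update_of_ne (Finset.ne_of_mem_erase hj)]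
  rw [h1, DD_GG _ _ hr]
  split_ifs with h
  · rw [← Finset.mul_prod_erase _ _ (Finset.mem_univ k), Function.update_self, smul_eq_C_mul,
      mul_assoc]
    congr 2
    refine Finset.prod_congr rfl fun j hj => ?_
    rw [Function.update_of_ne (Finset.ne_of_mem_erase hj)]
  · simp

theorem TT_prod {K : Type*} [DecidableEq K] [Fintype K] (ε : K → ℚ) (l : List ℕ)
    (hl : ∀ r ∈ l, 0 < r) (d : K → ℕ) :
    TT l (∏ k, GG (ε k) (d k)) = ∑ F : Fin l.length → K,
      if ∀ k, ∑ r ∈ Finset.univ.filter (fun r => F r = k), l.get r = d k then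
        ∏ r, ε (F r) ^ (l.get r + 1) else 0 := by
  induction l generalizing d with
  | nil =>
    rw [TT_nil, map_prod]
    simp only [aeval_zero_GG]
    rw [Finset.prod_ite_zero]
    have : Unique (Fin ([] : List ℕ).length → K) := inferInstanceAs (Unique (Fin 0 → K))
    rw [Fintype.sum_unique]
    simp
  | cons r l ih =>
    have hr := hl r (by simp)
    rw [TT_cons, DD_prod _ _ _ hr, map_sum]
    refine Eq.trans ?_ (Equiv.sum_comp (Fin.consEquiv (fun _ : Fin (l.length + 1) => K)) _)
    rw [Fintype.sum_prod_type]
    refine Finset.sum_congr rfl fun k _ => ?_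
    by_cases hk : r ≤ d k
    · rw [if_pos hk, map_smul, ih (fun x hx => hl x (by simp [hx])), Finset.smul_sum]
      refine Finset.sum_congr rfl fun F _ => ?_
      have e1 : (∀ k', ∑ s ∈ Finset.univ.filter (fun s => F s = k'), l.get s =
          Function.update d k (d k - r) k') ↔
          (∀ k', ∑ s ∈ Finset.univ.filter (fun s : Fin (l.length + 1) =>
            (Fin.consEquiv (fun _ => K)) (k, F) s = k'), (r :: l).get s = d k') := by
        refine forall_congr' fun k' => ?_
        rw [Finset.sum_filter, Finset.sum_filter, Fin.sum_univ_succ]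
        by_cases hkk : k' = k
        · subst hkk
          simp
          omega
        · simp [Function.update_of_ne hkk, Ne.symm hkk]
      have e2 : ε k ^ (r + 1) * ∏ s, ε (F s) ^ (l.get s + 1) =
          ∏ s : Fin (l.length + 1), ε ((Fin.consEquiv (fun _ => K)) (k, F) s) ^ ((r :: l).get s + 1) := by
        rw [Fin.prod_univ_succ]; simp
      rw [smul_ite, smul_eq_mul, smul_zero]
      exact if_congr e1 e2 rfl
    · rw [if_neg hk, map_zero, Finset.sum_eq_zero]
      intro F _
      rw [if_neg]
      intro h
      have := h k
      rw [Finset.sum_filter] at this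
      erw [Fin.sum_univ_succ] at this
      simp at this
      omega

theorem eN_eq (N b : ℕ) : eN N b = esymm (Fin N) ℚ b := rfl
theorem pN_eq (N b : ℕ) : pN N b = psum (Fin N) ℚ b := rfl

theorem eN_rec (N n : ℕ) : C (n : ℚ) * eN N n =
    ∑ i ∈ Finset.range n, C ((-1 : ℚ) ^ (i + 2)) * pN N (i + 1) * eN N (n - (i + 1)) := by
  have h := mul_esymm_eq_sum (Fin N) ℚ n
  simp only [eN_eq, pN_eq]
  rw [map_natCast, h, Finset.sum_filter, Finset.Nat.sum_antidiagonal_eq_sum_range_succ_mk,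
    Finset.sum_range_succ, if_neg (by simp), add_zero, ← Finset.sum_range_reflect, Finset.mul_sum]
  refine Finset.sum_congr rfl fun i hi => ?_
  rw [Finset.mem_range] at hi
  have e1 : n - 1 - i = n - (i + 1) := by omega
  have e2 : n - (n - (i + 1)) = i + 1 := by omega
  simp only [e1]
  rw [if_pos (by omega), e2, map_pow, map_neg, C_1, ← mul_assoc, ← mul_assoc, ← pow_add]
  have e3 : (-1 : MvPolynomial (Fin N) ℚ) ^ (n + 1 + (n - (i + 1))) = (-1) ^ (i + 2) := by
    have : n + 1 + (n - (i + 1)) + (i + 2) = 2 * (n + 1) := by omega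
    rw [neg_one_pow_congr]
    rw [Nat.even_iff, Nat.even_iff]
    omega
  rw [e3]; ring

theorem coeff_hN (N n : ℕ) (t : Fin N →₀ ℕ) :
    coeff t (hN N n) = if ∑ j, t j = n then 1 else 0 := by
  have h1 : ∀ s : Sym (Fin N) n, ((s : Multiset (Fin N)).map X).prod =
      (monomial (Multiset.toFinsupp (s : Multiset (Fin N))) (1 : ℚ)) := by
    intro s
    generalize (s : Multiset (Fin N)) = m
    induction m using Multiset.induction_on with
    | empty => simp
    | cons a m ih =>
      rw [Multiset.map_cons, Multiset.prod_cons, ih, ← Multiset.singleton_add, map_add,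
        Multiset.toFinsupp_singleton, X, monomial_mul, one_mul]
  have h2 : ∀ m : Multiset (Fin N), ∑ j, m.toFinsupp j = Multiset.card m := by
    intro m
    simp
  rw [hN, coeff_sum]
  simp only [h1, coeff_monomial]
  split_ifs with h
  · have hc : Multiset.card (Finsupp.toMultiset t) = n := by
      rw [← h, ← h2]; simp
    refine (Finset.sum_eq_single (⟨Finsupp.toMultiset t, hc⟩ : Sym (Fin N) n) ?_ ?_).trans ?_
    · intro b _ hb
      rw [if_neg]
      intro hbt
      apply hb
      apply Subtype.ext
      simp only [← hbt, Multiset.toFinsupp_toMultiset]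
      rfl
    · intro h; exact absurd (Finset.mem_univ (α := Sym (Fin N) n) _) h
    · rw [if_pos]
      exact Finsupp.toMultiset_toFinsupp t
  · apply Finset.sum_eq_zero
    intro s _
    rw [if_neg]
    rintro rfl
    apply h
    rw [h2]
    exact s.2

theorem hN_rec (N n : ℕ) : C (n : ℚ) * hN N n =
    ∑ i ∈ Finset.range n, C ((1 : ℚ) ^ (i + 2)) * pN N (i + 1) * hN N (n - (i + 1)) := by
  ext t
  simp only [one_pow, C_1, one_mul, pN, Finset.sum_mul, coeff_sum, coeff_C_mul]
  have h1 : ∀ i ∈ Finset.range n, ∀ j : Fin N, coeff t (X j ^ (i + 1) * hN N (n - (i + 1))) =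
      if i + 1 ≤ t j then (if ∑ j, t j = n then (1 : ℚ) else 0) else 0 := by
    intro i hi j
    rw [Finset.mem_range] at hi
    rw [X_pow_eq_monomial, coeff_monomial_mul', one_mul, coeff_hN]
    have e0 : Finsupp.single j (i + 1) ≤ t ↔ i + 1 ≤ t j := Finsupp.single_le_iff
    simp only [e0]
    by_cases h2 : i + 1 ≤ t j
    · rw [if_pos h2, if_pos h2]
      have e1 : t = (t - Finsupp.single j (i + 1)) + Finsupp.single j (i + 1) :=
        (tsub_add_cancel_of_le (e0.2 h2)).symm
      have e2 : ∑ k, t k = ∑ k, (t - Finsupp.single j (i + 1)) k + (i + 1) := by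
        conv_lhs => rw [e1]
        simp only [Finsupp.add_apply, Finset.sum_add_distrib]
        congr 1
        simp only [Finsupp.single_apply, Finset.sum_ite_eq, Finset.mem_univ, if_true]
      refine if_congr ?_ rfl rfl
      omega
    · rw [if_neg h2, if_neg h2]
  rw [Finset.sum_congr rfl fun i hi => Finset.sum_congr rfl fun j _ => h1 i hi j]
  rw [Finset.sum_comm, coeff_hN]
  by_cases h : ∑ j, t j = n
  · simp only [if_pos h]
    rw [mul_one]
    conv_lhs => rw [← h]
    rw [Nat.cast_sum]
    refine Finset.sum_congr rfl fun j _ => ?_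
    have : t j ≤ n := by rw [← h]; exact Finset.single_le_sum (f := fun j => t j) (by simp) (Finset.mem_univ j)
    rw [← Finset.sum_filter]
    have e : Finset.filter (fun i => i + 1 ≤ t j) (Finset.range n) = Finset.range (t j) := by
      ext i; simp; omega
    rw [e]; simp
  · simp [h]

theorem hN_zero (N : ℕ) : hN N 0 = 1 := hsymm_zero (Fin N) ℚ
theorem eN_zero (N : ℕ) : eN N 0 = 1 := esymm_zero (Fin N) ℚ

theorem psum_surj (N : ℕ) : Function.Surjective (aeval (R := ℚ) (fun i : Fin N =>
    (⟨psum (Fin N) ℚ (i + 1), psum_isSymmetric _ _ _⟩ : symmetricSubalgebra (Fin N) ℚ))) := by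
  set θ := (aeval (R := ℚ) (fun i : Fin N =>
    (⟨psum (Fin N) ℚ (i + 1), psum_isSymmetric _ _ _⟩ : symmetricSubalgebra (Fin N) ℚ))) with hθ
  have key : ∀ n, n ≤ N → ∃ q, (θ q : MvPolynomial (Fin N) ℚ) = eN N n := by
    intro n
    induction n using Nat.strong_induction_on with
    | _ n ih =>
    intro hn
    rcases Nat.eq_zero_or_pos n with rfl | hpos
    · exact ⟨1, by simp [eN_zero]⟩
    have h1 : ∀ i : Fin n, ∃ q, (θ q : MvPolynomial (Fin N) ℚ) = eN N (n - (i + 1)) :=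
      fun i => ih _ (by omega) (by omega)
    choose q hq using h1
    refine ⟨C ((n : ℚ)⁻¹) * ∑ i : Fin n, C ((-1 : ℚ) ^ ((i : ℕ) + 2)) * X ⟨i, by omega⟩ * q i, ?_⟩
    have hX : ∀ i : Fin N, (θ (X i) : MvPolynomial (Fin N) ℚ) = pN N (i + 1) := by
      intro i; rw [hθ, aeval_X]; rfl
    have hC : ∀ a : ℚ, (θ (C a) : MvPolynomial (Fin N) ℚ) = C a := by
      intro a; rw [hθ, aeval_C]; rfl
    have : (n : ℚ)⁻¹ * n = 1 := by field_simp
    rw [map_mul, map_sum, Subalgebra.coe_mul, hC, AddSubmonoidClass.coe_finsetSum]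
    simp only [map_mul, Subalgebra.coe_mul, hC, hX, hq]
    rw [← Finset.sum_range (fun i => C ((-1 : ℚ) ^ (i + 2)) * pN N (i + 1) * eN N (n - (i + 1))),
      ← eN_rec, ← mul_assoc, ← C_mul, this, C_1, one_mul]
  have h2 : ∀ i : Fin N, ∃ q, θ q =
      (⟨esymm (Fin N) ℚ (i + 1), esymm_isSymmetric _ _ _⟩ : symmetricSubalgebra (Fin N) ℚ) := by
    intro i
    obtain ⟨q, hq⟩ := key (i + 1) (by omega)
    exact ⟨q, Subtype.ext hq⟩
  choose q hq using h2
  intro y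
  obtain ⟨x, rfl⟩ := esymmAlgHom_surjective (σ := Fin N) (n := N) ℚ (by simp) y
  refine ⟨aeval q x, ?_⟩
  rw [← AlgHom.comp_apply]
  congr 1
  apply MvPolynomial.algHom_ext
  intro i
  simp [hq, esymmAlgHom]

theorem ringHom_inj_of_surj {R : Type*} [CommRing R] [IsNoetherianRing R] (f : R →+* R)
    (hf : Function.Surjective f) : Function.Injective f := by
  let g : ℕ →o Ideal R := ⟨fun n => RingHom.ker (f ^ n), by
    refine monotone_nat_of_le_succ fun n x hx => ?_
    rw [RingHom.mem_ker] at hx ⊢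
    rw [pow_succ', RingHom.mul_def, RingHom.comp_apply, hx, map_zero]⟩
  obtain ⟨n, hn⟩ := monotone_stabilizes_iff_noetherian.mpr (inferInstanceAs (IsNoetherian R R)) g
  rw [injective_iff_map_eq_zero]
  intro x hx
  have hs : Function.Surjective (f ^ n) := by
    rw [RingHom.coe_pow]; exact hf.iterate n
  obtain ⟨y, rfl⟩ := hs x
  have h1 : y ∈ g (n + 1) := by
    change y ∈ RingHom.ker (f ^ (n + 1))
    rw [RingHom.mem_ker, pow_succ', RingHom.mul_def, RingHom.comp_apply, hx]
  rw [← hn (n + 1) (by omega)] at h1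
  exact h1

theorem psum_inj (N : ℕ) : Function.Injective (aeval (R := ℚ) (fun i : Fin N =>
    pN N (i + 1))) := by
  have h1 := psum_surj N
  set θ := (aeval (R := ℚ) (fun i : Fin N =>
    (⟨psum (Fin N) ℚ (i + 1), psum_isSymmetric _ _ _⟩ : symmetricSubalgebra (Fin N) ℚ))) with hθ
  let e := (esymmAlgEquiv (n := N) (Fin N) ℚ (by simp)).symm
  have h2 : Function.Injective (e ∘ θ) :=
    ringHom_inj_of_surj (e.toRingEquiv.toRingHom.comp θ.toRingHom) (e.surjective.comp h1)
  have h3 : Function.Injective θ := by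
    intro x y hxy
    apply h2
    simp [hxy]
  have h4 : aeval (R := ℚ) (fun i : Fin N => pN N (i + 1)) =
      (symmetricSubalgebra (Fin N) ℚ).val.comp θ := by
    apply MvPolynomial.algHom_ext
    intro i
    simp [hθ, pN_eq]
  rw [h4]
  exact Subtype.val_injective.comp h3

noncomputable def PP (m : Multiset ℕ) : MvPolynomial ℕ ℚ := (m.map X).prod

theorem PP_add (m m' : Multiset ℕ) : PP (m + m') = PP m * PP m' := by simp [PP]

theorem PP_eq (m : Multiset ℕ) : PP m = monomial (Multiset.toFinsupp m) 1 := by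
  induction m using Multiset.induction_on with
  | empty => simp [PP]
  | cons a m ih =>
    rw [← Multiset.singleton_add, PP_add, ih, map_add, Multiset.toFinsupp_singleton]
    simp [PP, X, monomial_mul]

def zM (m : Multiset ℕ) : ℕ :=
  ∏ i ∈ m.toFinset, i ^ m.count i * Nat.factorial (m.count i)

theorem zM_eq (m : Multiset ℕ) (s : Finset ℕ) (h : m.toFinset ⊆ s) :
    zM m = ∏ i ∈ s, i ^ m.count i * Nat.factorial (m.count i) := by
  apply Finset.prod_subset h
  intro x _ hx
  rw [Multiset.mem_toFinset] at hx
  simp [Multiset.count_eq_zero_of_notMem hx]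

theorem zM_cons (r : ℕ) (m : Multiset ℕ) : zM (r ::ₘ m) = (m.count r + 1) * r * zM m := by
  rw [zM_eq (r ::ₘ m) _ subset_rfl, zM_eq m (r ::ₘ m).toFinset (by intro x; simp; tauto)]
  have hr : r ∈ (r ::ₘ m).toFinset := by simp
  rw [← Finset.mul_prod_erase _ _ hr, ← Finset.mul_prod_erase _ (fun i => i ^ m.count i * _) hr]
  rw [Multiset.count_cons_self, Nat.factorial_succ, pow_succ]
  have : ∏ x ∈ (r ::ₘ m).toFinset.erase r,
      x ^ Multiset.count x (r ::ₘ m) * (Multiset.count x (r ::ₘ m)).factorial =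
      ∏ x ∈ (r ::ₘ m).toFinset.erase r, x ^ Multiset.count x m * (Multiset.count x m).factorial := by
    refine Finset.prod_congr rfl fun x hx => ?_
    rw [Multiset.count_cons_of_ne (Finset.ne_of_mem_erase hx)]
  rw [this]; ring

theorem TT_eq (l : List ℕ) (q : MvPolynomial ℕ ℚ) :
    TT l q = zM (l : Multiset ℕ) * coeff (Multiset.toFinsupp (l : Multiset ℕ)) q := by
  induction l generalizing q with
  | nil =>
    rw [TT_nil]
    have : (aeval (fun _ : ℕ => (0 : ℚ))) q = constantCoeff q := by
      rw [aeval_zero']; rfl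
    rw [this]
    simp [zM, constantCoeff_eq]
  | cons r l ih =>
    rw [TT_cons, ih, DD, Derivation.smul_apply, coeff_smul, coeff_pderiv, ← Multiset.cons_coe,
      zM_cons, ← Multiset.singleton_add, map_add, Multiset.toFinsupp_singleton, add_comm]
    rw [Multiset.toFinsupp_apply]
    push_cast
    simp only [smul_eq_mul]
    ring

theorem TT_PP {c : ℕ} (mu nu : Nat.Partition c) :
    TT mu.parts.toList (PP nu.parts) = if nu = mu then (zPart mu : ℚ) else 0 := by
  rw [TT_eq, Multiset.coe_toList, PP_eq, coeff_monomial]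
  have : Multiset.toFinsupp nu.parts = Multiset.toFinsupp mu.parts ↔ nu = mu := by
    exact ⟨fun h => Nat.Partition.ext (Multiset.toFinsupp.injective h), fun h => by rw [h]⟩
  simp only [this]
  split_ifs
  · simp [zM, zPart]
  · simp

noncomputable def SS (n : ℕ) : Submodule ℚ (MvPolynomial ℕ ℚ) :=
  Submodule.span ℚ (Set.range fun nu : Nat.Partition n => PP nu.parts)

theorem PP_mem (m : Multiset ℕ) (hm : ∀ x ∈ m, 0 < x) : PP m ∈ SS m.sum :=
  Submodule.subset_span ⟨⟨m, fun {x} hx => hm x hx, rfl⟩, rfl⟩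

theorem SS_mul {n m : ℕ} {x y : MvPolynomial ℕ ℚ} (hx : x ∈ SS n) (hy : y ∈ SS m) :
    x * y ∈ SS (n + m) := by
  have : SS n * SS m ≤ SS (n + m) := by
    rw [SS, SS, Submodule.span_mul_span, Submodule.span_le]
    rintro _ ⟨_, ⟨nu, rfl⟩, _, ⟨nu', rfl⟩, rfl⟩
    have h := PP_mem (nu.parts + nu'.parts) (by
      intro x hx
      rcases Multiset.mem_add.1 hx with h | h
      · exact nu.parts_pos h
      · exact nu'.parts_pos h)
    rw [Multiset.sum_add, nu.parts_sum, nu'.parts_sum, PP_add] at h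
    exact h
  exact this (Submodule.mul_mem_mul hx hy)

theorem SS_one : (1 : MvPolynomial ℕ ℚ) ∈ SS 0 := by
  simpa [PP] using PP_mem 0 (by simp)

theorem GG_mem (ε : ℚ) (n : ℕ) : GG ε n ∈ SS n := by
  induction n using Nat.strong_induction_on with
  | _ n ih =>
  cases n with
  | zero => rw [GG_zero]; exact SS_one
  | succ n =>
    rw [GG, ← smul_eq_C_mul]
    refine Submodule.smul_mem _ _ (Submodule.sum_mem _ fun i _ => ?_)
    rw [mul_assoc, ← smul_eq_C_mul]
    refine Submodule.smul_mem _ _ ?_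
    have h1 : (X ((i : ℕ) + 1) : MvPolynomial ℕ ℚ) ∈ SS (i + 1) := by
      simpa [PP] using PP_mem {(i : ℕ) + 1} (by simp)
    have h2 := SS_mul h1 (ih (n - i) (by omega))
    have : (i : ℕ) + 1 + (n - i) = n + 1 := by omega
    rwa [this] at h2

theorem prod_mem_SS {K : Type*} (s : Finset K) (ε : K → ℚ) (d : K → ℕ) :
    ∏ k ∈ s, GG (ε k) (d k) ∈ SS (∑ k ∈ s, d k) := by
  classical
  induction s using Finset.induction_on with
  | empty => simpa using SS_one
  | insert a s ha ih =>
    rw [Finset.prod_insert ha, Finset.sum_insert ha]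
    exact SS_mul (GG_mem _ _) ih

noncomputable def psi (N : ℕ) : MvPolynomial ℕ ℚ →ₐ[ℚ] MvPolynomial (Fin N) ℚ := aeval (pN N)

theorem psi_PP (N : ℕ) (m : Multiset ℕ) : psi N (PP m) = (m.map (pN N)).prod := by
  rw [PP, map_multiset_prod, Multiset.map_map]
  simp [psi, Function.comp_def]

theorem psi_GG (N : ℕ) (ε : ℚ) (f : ℕ → MvPolynomial (Fin N) ℚ) (h0 : f 0 = 1)
    (hf : ∀ n : ℕ, C (n : ℚ) * f n =
      ∑ i ∈ Finset.range n, C (ε ^ (i + 2)) * pN N (i + 1) * f (n - (i + 1))) (n : ℕ) :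
    psi N (GG ε n) = f n := by
  induction n using Nat.strong_induction_on with
  | _ n ih =>
  rcases Nat.eq_zero_or_pos n with rfl | hn
  · rw [GG_zero, h0, map_one]
  apply C_cancel hn.ne'
  have hC : ∀ a, psi N (C a) = C a := by intro a; simp [psi]
  rw [hf, ← hC, ← map_mul, GG_rec, map_sum]
  refine Finset.sum_congr rfl fun i hi => ?_
  rw [Finset.mem_range] at hi
  rw [map_mul, map_mul, hC, ih _ (by omega)]
  simp [psi]

theorem psi_inj {N c : ℕ} (hNc : c ≤ N) {x y : MvPolynomial ℕ ℚ} (hx : x ∈ SS c) (hy : y ∈ SS c)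
    (h : psi N x = psi N y) : x = y := by
  let g : Fin N → ℕ := fun i => i + 1
  have h1 : SS c ≤ Subalgebra.toSubmodule (rename (R := ℚ) g).range := by
    rw [SS, Submodule.span_le]
    rintro _ ⟨nu, rfl⟩
    change PP nu.parts ∈ (rename (R := ℚ) g).range
    rw [PP]
    refine Subalgebra.multiset_prod_mem _ ?_
    intro z hz
    obtain ⟨r, hr, rfl⟩ := Multiset.mem_map.1 hz
    have hr0 := nu.parts_pos hr
    have hrc : r ≤ c := by
      have := Multiset.le_sum_of_mem hr
      rwa [nu.parts_sum] at this
    refine ⟨X ⟨r - 1, by omega⟩, ?_⟩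
    have : r - 1 + 1 = r := by omega
    simp [g, this]
  obtain ⟨x', rfl⟩ := h1 hx
  obtain ⟨y', rfl⟩ := h1 hy
  have h2 : ∀ z, psi N (rename (R := ℚ) g z) = aeval (fun i : Fin N => pN N (i + 1)) z := by
    intro z
    rw [psi, aeval_rename]; rfl
  change psi N (rename g x') = psi N (rename g y') at h
  rw [h2, h2] at h
  rw [psum_inj N h]

theorem prod_parts {A : Type*} [CommMonoid A] (m : Multiset ℕ) (f : ℕ → A) :
    (m.map f).prod = ∏ i : Fin m.toList.length, f (m.toList.get i) := by
  conv_lhs => rw [← Multiset.coe_toList m]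
  rw [Multiset.map_coe, Multiset.prod_coe]
  simp

theorem sum_parts (m : Multiset ℕ) :
    m.sum = ∑ i : Fin m.toList.length, m.toList.get i := by
  conv_lhs => rw [← Multiset.coe_toList m]
  rw [Multiset.sum_coe]
  simp

def epsK (A B : Type*) : Option (A ⊕ B) → ℚ
  | none => 1
  | some (.inl _) => 1
  | some (.inr _) => -1

def dK {A B : Type*} (n : ℕ) (f : A → ℕ) (g : B → ℕ) : Option (A ⊕ B) → ℕ
  | none => n
  | some (.inl i) => f i
  | some (.inr j) => g j

end Aux

/-- For partitions `λ ⊢ a`, `τ ⊢ b`, `μ ⊢ c` with `c ≥ a + b` and `N ≥ c`: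
there are unique rationals `(c_ν)_{ν ⊢ c}` with
`h_{c−a−b}·h_λ·e_τ = Σ_{ν ⊢ c} c_ν p_ν` in `ℚ[y_1,…,y_N]`; and for this family,
`z_μ·c_μ = Σ_F wt(F)`, the weighted count of row-fillings `F` of `μ` by labels
`i ∈ {1,…,ℓ(λ)}` (unprimed) or `j' ∈ {1,…,ℓ(τ)}` (primed) in which the rows labeled `i` have
total length `λ_i`, those labeled `j'` have total length `τ_j`, with
`wt(F) = ∏_{rows r with a primed label} (−1)^{μ_r+1}`. -/
theorem coeff_powerSum_expansion (N a b c : ℕ)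
    (lam : Nat.Partition a) (tau : Nat.Partition b) (mu : Nat.Partition c)
    (hsize : a + b ≤ c) (hNc : c ≤ N) :
    (∃! coef : Nat.Partition c → ℚ,
        hN N (c - a - b) * (lam.parts.map (hN N)).prod * (tau.parts.map (eN N)).prod =
          ∑ ν : Nat.Partition c, MvPolynomial.C (coef ν) * (ν.parts.map (pN N)).prod) ∧
      ∀ coef : Nat.Partition c → ℚ,
        (hN N (c - a - b) * (lam.parts.map (hN N)).prod * (tau.parts.map (eN N)).prod =
            ∑ ν : Nat.Partition c, MvPolynomial.C (coef ν) * (ν.parts.map (pN N)).prod) →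
          (zPart mu : ℚ) * coef mu =
            ∑ F ∈ Finset.univ.filter
                (fun F : Fin mu.parts.toList.length →
                    Option (Fin lam.parts.toList.length ⊕ Fin tau.parts.toList.length) =>
                  (∀ i, ∑ r ∈ Finset.univ.filter (fun r => F r = some (Sum.inl i)),
                      mu.parts.toList.get r = lam.parts.toList.get i) ∧
                  (∀ j, ∑ r ∈ Finset.univ.filter (fun r => F r = some (Sum.inr j)),
                      mu.parts.toList.get r = tau.parts.toList.get j)),
              ∏ r : Fin mu.parts.toList.length,
                (if ∃ j, F r = some (Sum.inr j) then
                    (-1 : ℚ) ^ (mu.parts.toList.get r + 1)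
                  else 1) := by
  classical
  set eps := epsK (Fin lam.parts.toList.length) (Fin tau.parts.toList.length) with heps
  set d := dK (c - a - b) lam.parts.toList.get tau.parts.toList.get with hd
  have hla : ∑ i, lam.parts.toList.get i = a := by rw [← sum_parts, lam.parts_sum]
  have htb : ∑ i, tau.parts.toList.get i = b := by rw [← sum_parts, tau.parts_sum]
  have hmem : ∏ k, GG (eps k) (d k) ∈ SS c := by
    have h := prod_mem_SS Finset.univ eps d
    have h2 : ∑ k, d k = c := by
      rw [Fintype.sum_option, Fintype.sum_sum_type]
      simp only [hd, dK]
      rw [hla, htb]; omega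
    rwa [h2] at h
  have hpsi : psi N (∏ k, GG (eps k) (d k)) =
      hN N (c - a - b) * (lam.parts.map (hN N)).prod * (tau.parts.map (eN N)).prod := by
    rw [map_prod, Fintype.prod_option, Fintype.prod_sum_type, prod_parts, prod_parts, mul_assoc]
    simp only [hd, dK, heps, epsK, psi_GG N 1 _ (hN_zero N) (hN_rec N),
      psi_GG N (-1) _ (eN_zero N) (eN_rec N)]
  have hsum : ∀ coef : Nat.Partition c → ℚ,
      psi N (∑ ν, coef ν • PP ν.parts) =
        ∑ ν : Nat.Partition c, MvPolynomial.C (coef ν) * (ν.parts.map (pN N)).prod := by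
    intro coef
    rw [map_sum]
    refine Finset.sum_congr rfl fun ν _ => ?_
    rw [map_smul, psi_PP, MvPolynomial.smul_eq_C_mul]
  have hex : ∃ coef : Nat.Partition c → ℚ,
      ∑ ν, coef ν • PP ν.parts = ∏ k, GG (eps k) (d k) :=
    (Submodule.mem_span_range_iff_exists_fun ℚ).1 hmem
  have hback : ∀ coef : Nat.Partition c → ℚ,
      (hN N (c - a - b) * (lam.parts.map (hN N)).prod * (tau.parts.map (eN N)).prod =
        ∑ ν : Nat.Partition c, MvPolynomial.C (coef ν) * (ν.parts.map (pN N)).prod) →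
      ∀ mu : Nat.Partition c,
        (zPart mu : ℚ) * coef mu = TT mu.parts.toList (∏ k, GG (eps k) (d k)) := by
    intro coef h mu
    rw [← hpsi, ← hsum] at h
    have h2 : ∑ ν, coef ν • PP ν.parts ∈ SS c :=
      Submodule.sum_mem _ fun ν _ => Submodule.smul_mem _ _ (Submodule.subset_span ⟨ν, rfl⟩)
    rw [psi_inj hNc hmem h2 h, map_sum]
    simp only [map_smul, TT_PP, smul_eq_mul]
    simp [mul_comm]
  have hz : ∀ mu : Nat.Partition c, (zPart mu : ℚ) ≠ 0 := by
    intro mu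
    rw [Nat.cast_ne_zero, zPart, Finset.prod_ne_zero_iff]
    intro i hi
    have := mu.parts_pos (Multiset.mem_toFinset.1 hi)
    positivity
  refine ⟨?_, ?_⟩
  · obtain ⟨coef, hcoef⟩ := hex
    refine ⟨coef, ?_, ?_⟩
    · change _ = _
      rw [← hpsi, ← hsum, hcoef]
    · intro coef' h'
      have h0 : hN N (c - a - b) * (lam.parts.map (hN N)).prod * (tau.parts.map (eN N)).prod =
        ∑ ν : Nat.Partition c, MvPolynomial.C (coef ν) * (ν.parts.map (pN N)).prod := by
        rw [← hpsi, ← hsum, hcoef]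
      funext ν
      exact mul_left_cancel₀ (hz ν) ((hback coef' h' ν).trans (hback coef h0 ν).symm)
  · intro coef h
    rw [hback coef h mu, TT_prod eps _ (fun r hr => mu.parts_pos (Multiset.mem_toList.1 hr)) d,
      Finset.sum_filter]
    refine Finset.sum_congr rfl fun F _ => ?_
    refine if_congr ?_ ?_ rfl
    · rw [Option.forall, Sum.forall]
      simp only [hd, dK]
      refine ⟨fun h => h.2, fun h => ⟨?_, h⟩⟩
      have htot : ∑ k, ∑ r ∈ Finset.univ.filter (fun r => F r = k), mu.parts.toList.get r = c := by
        rw [Finset.sum_fiberwise, ← sum_parts, mu.parts_sum]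
      rw [Fintype.sum_option, Fintype.sum_sum_type, Finset.sum_congr rfl fun i _ => h.1 i,
        Finset.sum_congr rfl fun i _ => h.2 i, hla, htb] at htot
      omega
    · refine Finset.prod_congr rfl fun r _ => ?_
      rcases hF : F r with _ | i | j
      · simp [heps, epsK]
      · simp [heps, epsK]
      · simp [heps, epsK]
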